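/- Let ℓ ≥ 2 be an integer, let e ∈ [1 − 1/ℓ, 1 − 1/(ℓ+1)], let c = (ℓ + √(ℓ(ℓ − e(ℓ+1))))/(ℓ(ℓ+1)), and let p = 4c(1 − ℓc)/(1 − (ℓ−1)c)². Let g be any graphon with e(g) = e such that, for almost every (x,y): g(x,y) = 1 whenever x < kc < y or y < kc < x for some integer k with 1 ≤ k ≤ ℓ−1; g(x,y) = 0 whenever (k−1)c < x,y < kc for some integer k with 1 ≤ k ≤ ℓ−1; ∫∫∫_{[(ℓ−1)c,1]³} g(x,y) g(y,z) g(z,x) dx dy dz = 0; and suppose I(g) = ((1 − (ℓ−1)c)²/2)·I₀(p). Then g is equivalent to the graphon g₀ defined by: g₀(x,y) = 1 if x < kc < y or y < kc < x for some integer k with 1 ≤ k ≤ ℓ−1; g₀(x,y) = p if (ℓ−1)c < x < [1 + (ℓ−1)c]/2 < y or (ℓ−1)c < y < [1 + (ℓ−1)c]/2 < x; and g₀(x,y) = 0 otherwise. -/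

import Mathlib

open MeasureTheory Real Set Filter

noncomputable section

/-- `I₀(u) = (1/2)[u ln u + (1-u) ln(1-u)]`, with the convention `log 0 = 0`
    giving `I₀(0) = I₀(1) = 0`. -/
def I0 (u : ℝ) : ℝ := (u * Real.log u + (1 - u) * Real.log (1 - u)) / 2

/-- `I₀'(u) = (1/2)[ln u − ln(1−u)]`. -/
def I0d (u : ℝ) : ℝ := (Real.log u - Real.log (1 - u)) / 2

/-- `I₀''(u) = (1/2)[1/u + 1/(1−u)]`. -/
def I0dd (u : ℝ) : ℝ := (1 / u + 1 / (1 - u)) / 2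

/-- A graphon: a measurable, symmetric function `[0,1]² → [0,1]`
    (here defined on all of `ℝ²`, with values used only on `[0,1]²`). -/
def IsGraphon (g : ℝ → ℝ → ℝ) : Prop :=
  Measurable (Function.uncurry g) ∧ (∀ x y, g x y = g y x) ∧ ∀ x y, g x y ∈ Icc (0 : ℝ) 1

/-- The edge density `e(g) = ∫₀¹∫₀¹ g(x,y) dx dy`. -/
def edgeDensity (g : ℝ → ℝ → ℝ) : ℝ :=
  ∫ x in Icc (0 : ℝ) 1, ∫ y in Icc (0 : ℝ) 1, g x y

/-- The triangle density `t(g) = ∫₀¹∫₀¹∫₀¹ g(x,y) g(y,z) g(z,x) dx dy dz`. -/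
def triangleDensity (g : ℝ → ℝ → ℝ) : ℝ :=
  ∫ x in Icc (0 : ℝ) 1, ∫ y in Icc (0 : ℝ) 1, ∫ z in Icc (0 : ℝ) 1, g x y * g y z * g z x

/-- The rate function `I(g) = ∫₀¹∫₀¹ I₀(g(x,y)) dx dy`. -/
def rate (g : ℝ → ℝ → ℝ) : ℝ :=
  ∫ x in Icc (0 : ℝ) 1, ∫ y in Icc (0 : ℝ) 1, I0 (g x y)

/-- Lebesgue measure restricted to `[0,1]`. -/
def unitMeasure : Measure ℝ := volume.restrict (Icc (0 : ℝ) 1)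

/-- Two graphons are equivalent if they agree a.e. after composing with
    measure-preserving maps of `[0,1]`. -/
def GraphonEquiv (f g : ℝ → ℝ → ℝ) : Prop :=
  ∃ σ σ' : ℝ → ℝ, MeasurePreserving σ unitMeasure unitMeasure ∧
    MeasurePreserving σ' unitMeasure unitMeasure ∧
    ∀ᵐ p ∂(unitMeasure.prod unitMeasure), f (σ p.1) (σ p.2) = g (σ' p.1) (σ' p.2)

end

open Classical in
/-- The optimizing multipartite graphon on the `ℓ`-th scallop: `1` across the
    first `ℓ−1` parts, a balanced bipartite block of height `p` in the corner
    `[(ℓ−1)c, 1]²`, and `0` elsewhere. -/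
noncomputable def gScallop (ℓ : ℕ) (c p : ℝ) : ℝ → ℝ → ℝ := fun x y =>
  if ∃ k : ℕ, 1 ≤ k ∧ k ≤ ℓ - 1 ∧
      ((x < (k : ℝ) * c ∧ (k : ℝ) * c < y) ∨ (y < (k : ℝ) * c ∧ (k : ℝ) * c < x)) then 1
  else if (((ℓ : ℝ) - 1) * c < x ∧ x < (1 + ((ℓ : ℝ) - 1) * c) / 2 ∧
            (1 + ((ℓ : ℝ) - 1) * c) / 2 < y) ∨
          (((ℓ : ℝ) - 1) * c < y ∧ y < (1 + ((ℓ : ℝ) - 1) * c) / 2 ∧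
            (1 + ((ℓ : ℝ) - 1) * c) / 2 < x) then p
  else 0


/-- A measurable set of finite Lebesgue measure can be mapped onto an interval of the same length
in a measure preserving way. -/
lemma exists_measurePreserving_restrict_Icc {A : Set ℝ} {u v : ℝ} (huv : u ≤ v)
    (hvol : volume A = ENNReal.ofReal (v - u)) :
    ∃ f : ℝ → ℝ, MeasurePreserving f (volume.restrict A) (volume.restrict (Icc u v)) ∧
      ∀ x, f x ∈ Icc u v := by
  set μ : Measure ℝ := volume.restrict A with hμ
  have hfin : IsFiniteMeasure μ := ⟨by simp [hμ, hvol]⟩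
  set F : ℝ → ℝ := fun x => μ.real (Iic x) with hF
  have hFmono : Monotone F := fun x y hxy => measureReal_mono (Iic_subset_Iic.2 hxy)
  have hF0 : ∀ x, 0 ≤ F x := fun x => measureReal_nonneg
  have huniv : μ univ = ENNReal.ofReal (v - u) := by simp [hμ, hvol]
  have hF1 : ∀ x, F x ≤ v - u := fun x => by
    have h : F x ≤ μ.real univ := measureReal_mono (subset_univ _)
    rwa [measureReal_def, huniv, ENNReal.toReal_ofReal (by linarith)] at h
  have hLip : ∀ x y, x ≤ y → F y ≤ F x + (y - x) := fun x y hxy => by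
    have h1 : μ.real (Iic y) ≤ μ.real (Iic x) + μ.real (Ioc x y) := by
      rw [← Iic_union_Ioc_eq_Iic hxy]; exact measureReal_union_le _ _
    have h2 : μ.real (Ioc x y) ≤ y - x := by
      have h3 : μ (Ioc x y) ≤ volume (Ioc x y) := Measure.restrict_apply_le _ _
      rw [Real.volume_Ioc] at h3
      exact ENNReal.toReal_le_of_le_ofReal (by linarith) h3
    simp only [hF]; linarith
  have hlevel : ∀ t, 0 ≤ t → t < v - u → μ {x | F x ≤ t} = ENNReal.ofReal t := by
    intro t ht0 ht1
    have hbot : Tendsto F atBot (nhds 0) := by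
      have h := tendsto_measure_iInter_atBot (μ := μ) (s := fun x : ℝ => Iic x)
        (fun _ => measurableSet_Iic.nullMeasurableSet) monotone_Iic ⟨0, measure_ne_top _ _⟩
      have hempty : ⋂ x : ℝ, Iic x = ∅ := iInter_Iic_eq_empty_iff.2 (by simp [not_bddBelow_univ])
      rw [hempty, measure_empty] at h
      exact (ENNReal.tendsto_toReal ENNReal.zero_ne_top).comp h
    have htop : Tendsto F atTop (nhds (v - u)) := by
      have h := tendsto_measure_Iic_atTop μ
      have h2 := (ENNReal.tendsto_toReal (measure_ne_top μ univ)).comp h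
      rw [huniv, ENNReal.toReal_ofReal (by linarith)] at h2
      exact h2
    by_cases hne : {x | F x ≤ t}.Nonempty
    · obtain ⟨b, hb⟩ := (htop.eventually (lt_mem_nhds ht1)).exists
      have hbdd : BddAbove {x | F x ≤ t} := ⟨b, fun x hx => by
        by_contra! hbx
        exact absurd (hFmono hbx.le) (not_le.2 (lt_of_le_of_lt hx hb))⟩
      set x₀ := sSup {x | F x ≤ t} with hx₀
      have hle : F x₀ ≤ t := by
        refine le_of_forall_pos_le_add fun ε hε => ?_
        obtain ⟨x, hx, hlt⟩ := exists_lt_of_lt_csSup hne (sub_lt_self x₀ hε)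
        have h1 := hLip x x₀ (le_csSup hbdd hx)
        have h2 : F x ≤ t := hx
        linarith
      have hge : t ≤ F x₀ := by
        by_contra! hlt
        have h1 := hLip x₀ (x₀ + (t - F x₀)) (by linarith)
        have h2 : x₀ + (t - F x₀) ≤ x₀ :=
          le_csSup hbdd (show F (x₀ + (t - F x₀)) ≤ t by linarith)
        linarith
      have hset : {x | F x ≤ t} = Iic x₀ :=
        Subset.antisymm (fun x hx => le_csSup hbdd hx) fun x hx => (hFmono hx).trans hle
      have hFx : F x₀ = t := le_antisymm hle hge
      rw [hset, ← hFx]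
      simp [hF]
    · have ht : t = 0 := by
        by_contra h
        obtain ⟨b, hb⟩ := (hbot.eventually (gt_mem_nhds (lt_of_le_of_ne ht0 (Ne.symm h)))).exists
        exact hne ⟨b, hb.le⟩
      rw [not_nonempty_iff_eq_empty.1 hne, ht]
      simp
  refine ⟨fun x => u + F x, ⟨hFmono.measurable.const_add u, ?_⟩,
    fun x => ⟨by linarith [hF0 x], by linarith [hF1 x]⟩⟩
  refine Measure.ext_of_Iic _ _ fun t => ?_
  rw [Measure.map_apply (hFmono.measurable.const_add u) measurableSet_Iic,
    Measure.restrict_apply measurableSet_Iic]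
  have hpre : (fun x => u + F x) ⁻¹' Iic t = {x | F x ≤ t - u} := by
    ext x
    simp only [mem_preimage, mem_Iic, mem_ofPred_eq]
    constructor <;> intro h <;> linarith
  rw [hpre]
  rcases lt_or_ge t u with htu | htu
  · have h1 : {x | F x ≤ t - u} = ∅ := by
      ext x; simp only [mem_ofPred_eq, mem_empty_iff_false, iff_false]; linarith [hF0 x]
    have h2 : Iic t ∩ Icc u v = ∅ := by
      ext x; simp only [mem_inter_iff, mem_Iic, mem_Icc, mem_empty_iff_false, iff_false]
      rintro ⟨h, h', -⟩; linarith
    simp [h1, h2]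
  rcases lt_or_ge t v with htv | htv
  · have h2 : Iic t ∩ Icc u v = Icc u t := by
      ext x; simp only [mem_inter_iff, mem_Iic, mem_Icc]
      exact ⟨fun h => ⟨h.2.1, h.1⟩, fun h => ⟨h.2, h.1, h.2.trans htv.le⟩⟩
    rw [h2, hlevel _ (by linarith) (by linarith), Real.volume_Icc]
  · have h1 : {x | F x ≤ t - u} = univ := by
      ext x; simp only [mem_ofPred_eq, mem_univ, iff_true]; linarith [hF1 x]
    have h2 : Iic t ∩ Icc u v = Icc u v :=
      inter_eq_right.2 fun x hx => hx.2.trans htv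
    rw [h1, h2, huniv, Real.volume_Icc]

lemma MeasureTheory.MeasurePreserving.piecewise_of_restrict {α β : Type*} [MeasurableSpace α]
    [MeasurableSpace β] {μ : Measure α} {ν₁ ν₂ : Measure β} {s : Set α} (hs : MeasurableSet s)
    [DecidablePred (· ∈ s)] {f g : α → β} (hf : MeasurePreserving f (μ.restrict s) ν₁)
    (hg : MeasurePreserving g (μ.restrict sᶜ) ν₂) :
    MeasurePreserving (s.piecewise f g) μ (ν₁ + ν₂) := by
  have hm : Measurable (s.piecewise f g) := hf.measurable.piecewise hs hg.measurable
  refine ⟨hm, ?_⟩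
  conv_lhs => rw [← Measure.restrict_add_restrict_compl (μ := μ) hs]
  rw [Measure.map_add _ _ hm, ← hf.map_eq, ← hg.map_eq]
  congr 1
  · exact Measure.map_congr (piecewise_ae_eq_restrict hs)
  · exact Measure.map_congr (piecewise_ae_eq_restrict_compl hs)

/-- There is a measure preserving map of `[0,1]` which is the identity off `[a,1]` and moves a half
`A` of `[a,1]` to the left half and its complement to the right half. -/
lemma exists_measurePreserving_sort {a : ℝ} (ha0 : 0 ≤ a) (ha1 : a ≤ 1) {A : Set ℝ}
    (hA : MeasurableSet A) (hAsub : A ⊆ Icc a 1)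
    (hvol : volume A = ENNReal.ofReal ((1 - a) / 2)) :
    ∃ τ : ℝ → ℝ, MeasurePreserving τ unitMeasure unitMeasure ∧
      (∀ x, x < a → τ x = x) ∧ (∀ x ∈ A, τ x ∈ Icc a ((1 + a) / 2)) ∧
      ∀ x ∈ Icc a 1 \ A, τ x ∈ Icc ((1 + a) / 2) 1 := by
  classical
  obtain ⟨f, hf, hfr⟩ := exists_measurePreserving_restrict_Icc (A := A) (u := a)
    (v := (1 + a) / 2) (by linarith) (by rw [hvol]; congr 1; ring)
  have hvol' : volume (Icc a 1 \ A) = ENNReal.ofReal (1 - (1 + a) / 2) := by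
    rw [measure_sdiff hAsub hA.nullMeasurableSet (by simp [hvol]), hvol, Real.volume_Icc,
      ← ENNReal.ofReal_sub _ (by linarith)]
    congr 1; ring
  obtain ⟨f', hf', hfr'⟩ := exists_measurePreserving_restrict_Icc (A := Icc a 1 \ A)
    (u := (1 + a) / 2) (v := 1) (by linarith) hvol'
  have hB : MeasurableSet (Icc a 1 \ A) := measurableSet_Icc.diff hA
  have e1 : unitMeasure.restrict A = volume.restrict A := by
    rw [unitMeasure, Measure.restrict_restrict hA,
      inter_eq_left.2 (hAsub.trans (Icc_subset_Icc_left ha0))]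
  have e2 : (unitMeasure.restrict Aᶜ).restrict (Icc a 1 \ A) = volume.restrict (Icc a 1 \ A) := by
    rw [unitMeasure, Measure.restrict_restrict hA.compl, Measure.restrict_restrict hB]
    congr 1
    ext x
    simp only [mem_inter_iff, Set.mem_sdiff, mem_compl_iff, mem_Icc]
    constructor
    · tauto
    · rintro ⟨⟨h1, h2⟩, h3⟩
      exact ⟨⟨⟨h1, h2⟩, h3⟩, h3, by linarith, h2⟩
  have e3 : (unitMeasure.restrict Aᶜ).restrict (Icc a 1 \ A)ᶜ = volume.restrict (Ico 0 a) := by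
    rw [unitMeasure, Measure.restrict_restrict hA.compl, Measure.restrict_restrict hB.compl]
    congr 1
    ext x
    simp only [mem_inter_iff, Set.mem_sdiff, mem_compl_iff, mem_Icc, mem_Ico]
    constructor
    · rintro ⟨h1, h2, h3, h4⟩
      refine ⟨h3, ?_⟩
      by_contra! h
      exact h1 ⟨⟨h, h4⟩, h2⟩
    · rintro ⟨h1, h2⟩
      exact ⟨fun h => absurd h.1.1 (not_le.2 h2), fun h => absurd (hAsub h).1 (not_le.2 h2),
        h1, by linarith⟩
  have e4 : volume.restrict (Icc a ((1 + a) / 2)) +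
      (volume.restrict (Icc ((1 + a) / 2) 1) + volume.restrict (Ico 0 a)) = unitMeasure := by
    have h1 : volume.restrict (Icc a ((1 + a) / 2)) = volume.restrict (Ico a ((1 + a) / 2)) :=
      Measure.restrict_congr_set Ico_ae_eq_Icc.symm
    rw [h1, ← add_assoc, ← Measure.restrict_union _ measurableSet_Icc,
      Ico_union_Icc_eq_Icc (by linarith) (by linarith), add_comm,
      ← Measure.restrict_union _ measurableSet_Icc, Ico_union_Icc_eq_Icc ha0 ha1, unitMeasure]
    · exact disjoint_left.2 fun x hx hx' => absurd hx.2 (not_lt.2 hx'.1)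
    · exact disjoint_left.2 fun x hx hx' => absurd hx.2 (not_lt.2 hx'.1)
  rw [← e1] at hf
  rw [← e2] at hf'
  have hid : MeasurePreserving (id : ℝ → ℝ) ((unitMeasure.restrict Aᶜ).restrict (Icc a 1 \ A)ᶜ)
      (volume.restrict (Ico 0 a)) := by
    rw [e3]; exact .id _
  have hτ := hf.piecewise_of_restrict hA (hf'.piecewise_of_restrict hB hid)
  rw [e4] at hτ
  refine ⟨_, hτ, fun x hx => ?_, fun x hx => ?_, fun x hx => ?_⟩
  · rw [piecewise_eq_of_notMem _ _ _ fun h => absurd (hAsub h).1 (not_le.2 hx),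
      piecewise_eq_of_notMem _ _ _ fun h => absurd h.1.1 (not_le.2 hx), id]
  · rw [piecewise_eq_of_mem _ _ _ hx]; exact hfr x
  · rw [piecewise_eq_of_notMem _ _ _ hx.2, piecewise_eq_of_mem _ _ _ hx]; exact hfr' x

lemma integrable_of_measurable_of_abs_le {α : Type*} [MeasurableSpace α] {μ : Measure α}
    [IsFiniteMeasure μ] {f : α → ℝ} (hf : Measurable f) (C : ℝ) (h : ∀ x, |f x| ≤ C) :
    Integrable f μ :=
  .of_bound hf.aestronglyMeasurable C (.of_forall h)

section Mantel

variable {Ω : Type*} [MeasurableSpace Ω] {μ : Measure Ω} [IsFiniteMeasure μ]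

/-- Mantel's inequality for triangle-free weights, with the deviation of the degree function from
half of the total mass as a remainder term. -/
lemma integral_degree_sub_half_sq_le {w : Ω → Ω → ℝ} (hw : Measurable (Function.uncurry w))
    (hsymm : ∀ x y, w x y = w y x) (h01 : ∀ x y, w x y ∈ Icc (0 : ℝ) 1)
    (htri : ∀ᵐ x ∂μ, ∀ᵐ y ∂μ, ∀ᵐ z ∂μ, w x y * w y z * w z x = 0) :
    ∫ x, ((∫ y, w x y ∂μ) - μ.real univ / 2) ^ 2 ∂μ ≤
      μ.real univ / 2 * (μ.real univ ^ 2 / 2 - ∫ x, ∫ y, w x y ∂μ ∂μ) := by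
  set L := μ.real univ with hL
  set d : Ω → ℝ := fun x => ∫ y, w x y ∂μ with hd
  have hL0 : 0 ≤ L := measureReal_nonneg
  have hwx : ∀ x, Measurable (w x) := fun x => hw.of_uncurry_left
  have hwint : ∀ x, Integrable (w x) μ := fun x =>
    integrable_of_measurable_of_abs_le (hwx x) 1 fun y =>
      abs_le.2 ⟨by linarith [(h01 x y).1], (h01 x y).2⟩
  have hdm : Measurable d := (hw.stronglyMeasurable.integral_prod_right' (ν := μ)).measurable
  have hd0 : ∀ x, 0 ≤ d x := fun x => integral_nonneg fun y => (h01 x y).1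
  have hdL : ∀ x, d x ≤ L := fun x => by
    have h := integral_mono (hwint x) (integrable_const (1 : ℝ)) fun y => (h01 x y).2
    simpa [hL] using h
  have hdabs : ∀ x, |d x| ≤ L := fun x => abs_le.2 ⟨by linarith [hd0 x], hdL x⟩
  have hdint : Integrable d μ := integrable_of_measurable_of_abs_le hdm L hdabs
  have hd2int : Integrable (fun x => d x ^ 2) μ :=
    integrable_of_measurable_of_abs_le (hdm.pow_const 2) (L ^ 2) fun x => by
      rw [abs_pow]; exact pow_le_pow_left₀ (abs_nonneg _) (hdabs x) 2
  have hwd_abs : ∀ x y, |w x y * d y| ≤ L := fun x y => by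
    rw [abs_mul, abs_of_nonneg (h01 x y).1]
    have h1 := (h01 x y).2
    have h2 := hdabs y
    have h3 := abs_nonneg (d y)
    nlinarith [(h01 x y).1]
  have hwdm : Measurable (Function.uncurry fun x y => w x y * d y) :=
    hw.mul (hdm.comp measurable_snd)
  have hwdint : Integrable (Function.uncurry fun x y => w x y * d y) (μ.prod μ) :=
    integrable_of_measurable_of_abs_le hwdm L fun q => hwd_abs q.1 q.2
  have hwdxint : ∀ x, Integrable (fun y => w x y * d y) μ := fun x =>
    integrable_of_measurable_of_abs_le ((hwx x).mul hdm) L fun y => hwd_abs x y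
  have key : ∀ᵐ x ∂μ, d x ^ 2 + ∫ y, w x y * d y ∂μ ≤ L * d x := by
    filter_upwards [htri] with x hx
    have h1 : ∀ᵐ y ∂μ, d x * w x y + w x y * d y ≤ L * w x y := by
      filter_upwards [hx] with y hy
      have h2 : ∫ z, w x y * (w x z + w y z) ∂μ ≤ ∫ _, w x y ∂μ := by
        refine integral_mono_ae (((hwint x).add (hwint y)).const_mul _) (integrable_const _) ?_
        filter_upwards [hy] with z hz
        have a1 := h01 x y
        have a2 := h01 x z
        have a3 := h01 y z
        rw [hsymm z x] at hz
        show w x y * (w x z + w y z) ≤ w x y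
        rcases mul_eq_zero.1 hz with h | h
        · rcases mul_eq_zero.1 h with h | h
          · simp [h]
          · rw [h]; nlinarith [a1.1, a2.2]
        · rw [h]; nlinarith [a1.1, a3.2]
      rw [integral_const_mul, integral_add (hwint x) (hwint y), integral_const, smul_eq_mul] at h2
      simp only [hd, hL]
      linarith
    have h3 := integral_mono_ae (((hwint x).const_mul _).add (hwdxint x))
      ((hwint x).const_mul L) h1
    rw [integral_add' ((hwint x).const_mul _) (hwdxint x), integral_const_mul,
      integral_const_mul] at h3
    simp only [hd] at h3 ⊢
    linarith
  have hswap : ∫ x, ∫ y, w x y * d y ∂μ ∂μ = ∫ x, d x ^ 2 ∂μ := by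
    rw [integral_integral_swap hwdint]
    refine integral_congr_ae (.of_forall fun y => ?_)
    simp only
    rw [integral_mul_const, sq]
    congr 1
    simp only [hd]
    exact integral_congr_ae (.of_forall fun x => hsymm x y)
  have hint2 : Integrable (fun x => ∫ y, w x y * d y ∂μ) μ := hwdint.integral_prod_left
  have hmain := integral_mono_ae (hd2int.add hint2) (hdint.const_mul L) key
  rw [integral_add' hd2int hint2, hswap, integral_const_mul] at hmain
  have hexp : ∫ x, (d x - L / 2) ^ 2 ∂μ = ∫ x, d x ^ 2 ∂μ - L * ∫ x, d x ∂μ + L ^ 3 / 4 := by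
    have h1 : ∀ x, (d x - L / 2) ^ 2 = d x ^ 2 - L * d x + L ^ 2 / 4 := fun x => by ring
    simp_rw [h1]
    rw [integral_add (f := fun x => d x ^ 2 - L * d x) (hd2int.sub (hdint.const_mul L))
      (integrable_const _), integral_sub hd2int (hdint.const_mul L), integral_const_mul, integral_const, smul_eq_mul,
      ← hL]
    ring
  rw [hexp]
  nlinarith

variable {S : Set (Ω × Ω)}

lemma integral_measureReal_section_sub_sq_le (hS : MeasurableSet S)
    (hsymm : ∀ x y, (x, y) ∈ S ↔ (y, x) ∈ S)
    (htri : ∀ᵐ x ∂μ, ∀ᵐ y ∂μ, ∀ᵐ z ∂μ, ¬((x, y) ∈ S ∧ (y, z) ∈ S ∧ (z, x) ∈ S)) :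
    ∫ x, (μ.real (Prod.mk x ⁻¹' S) - μ.real univ / 2) ^ 2 ∂μ ≤
      μ.real univ / 2 * (μ.real univ ^ 2 / 2 - (μ.prod μ).real S) := by
  classical
  have hm : Measurable (S.indicator (1 : Ω × Ω → ℝ)) := measurable_one.indicator hS
  have hdeg : ∀ x, ∫ y, S.indicator (1 : Ω × Ω → ℝ) (x, y) ∂μ = μ.real (Prod.mk x ⁻¹' S) :=
    fun x => integral_indicator_one (measurable_prodMk_left hS)
  have hint : Integrable (S.indicator (1 : Ω × Ω → ℝ)) (μ.prod μ) :=
    (integrable_const (1 : ℝ)).indicator hS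
  have hdens : ∫ x, ∫ y, S.indicator (1 : Ω × Ω → ℝ) (x, y) ∂μ ∂μ = (μ.prod μ).real S := by
    rw [← integral_prod _ hint, integral_indicator_one hS]
  have h := integral_degree_sub_half_sq_le (μ := μ)
    (w := fun x y => S.indicator (1 : Ω × Ω → ℝ) (x, y)) hm
    (fun x y => by simp only [indicator_apply, hsymm x y, Pi.one_apply])
    (fun x y => by simp only [indicator_apply]; split_ifs <;> simp)
    (by
      filter_upwards [htri] with x hx
      filter_upwards [hx] with y hy
      filter_upwards [hy] with z hz
      simp only [indicator_apply]
      split_ifs <;> simp_all)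
  rw [hdens] at h
  simpa only [hdeg] using h

/-- Mantel's theorem for a symmetric triangle-free relation on a finite measure space. -/
lemma measureReal_prod_le_of_triangleFree (hS : MeasurableSet S)
    (hsymm : ∀ x y, (x, y) ∈ S ↔ (y, x) ∈ S)
    (htri : ∀ᵐ x ∂μ, ∀ᵐ y ∂μ, ∀ᵐ z ∂μ, ¬((x, y) ∈ S ∧ (y, z) ∈ S ∧ (z, x) ∈ S)) :
    (μ.prod μ).real S ≤ μ.real univ ^ 2 / 2 := by
  have h := (integral_nonneg fun x => sq_nonneg _).trans
    (integral_measureReal_section_sub_sq_le hS hsymm htri)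
  rcases (measureReal_nonneg : 0 ≤ μ.real univ).eq_or_lt with h0 | h0
  · have hle : (μ.prod μ).real S ≤ (μ.prod μ).real univ := measureReal_mono (subset_univ _)
    rw [← univ_prod_univ, measureReal_prod_prod, ← h0] at hle
    rw [← h0]
    simpa using hle
  · by_contra! hlt
    nlinarith

/-- Extremal case of Mantel's theorem: a symmetric triangle-free relation of maximal density is
almost everywhere complete bipartite with balanced parts. -/
lemma exists_balanced_bipartition (hS : MeasurableSet S)
    (hsymm : ∀ x y, (x, y) ∈ S ↔ (y, x) ∈ S)
    (htri : ∀ᵐ x ∂μ, ∀ᵐ y ∂μ, ∀ᵐ z ∂μ, ¬((x, y) ∈ S ∧ (y, z) ∈ S ∧ (z, x) ∈ S))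
    (hcard : (μ.prod μ).real S = μ.real univ ^ 2 / 2) :
    ∃ A : Set Ω, MeasurableSet A ∧ μ.real A = μ.real univ / 2 ∧
      ∀ᵐ q ∂μ.prod μ, q ∈ S ↔ ¬(q.1 ∈ A ↔ q.2 ∈ A) := by
  rcases eq_zero_or_neZero μ with rfl | hμ
  · exact ⟨∅, .empty, by simp, by simp⟩
  have hsec : ∀ x, MeasurableSet (Prod.mk x ⁻¹' S) := fun x => measurable_prodMk_left hS
  have hdm : Measurable fun x => μ.real (Prod.mk x ⁻¹' S) :=
    (measurable_measure_prodMk_left hS).ennreal_toReal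
  have hdeg : ∀ᵐ x ∂μ, μ.real (Prod.mk x ⁻¹' S) = μ.real univ / 2 := by
    have h := integral_measureReal_section_sub_sq_le hS hsymm htri
    rw [hcard, sub_self, mul_zero] at h
    have h0 := le_antisymm h (integral_nonneg fun x => sq_nonneg _)
    have hint : Integrable (fun x => (μ.real (Prod.mk x ⁻¹' S) - μ.real univ / 2) ^ 2) μ := by
      refine integrable_of_measurable_of_abs_le ((hdm.sub_const _).pow_const 2)
        (μ.real univ ^ 2) fun x => ?_
      rw [abs_pow]
      refine pow_le_pow_left₀ (abs_nonneg _) (abs_le.2 ?_) 2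
      have h1 : μ.real (Prod.mk x ⁻¹' S) ≤ μ.real univ := measureReal_mono (subset_univ _)
      have h2 : 0 ≤ μ.real (Prod.mk x ⁻¹' S) := measureReal_nonneg
      constructor <;> linarith
    filter_upwards [(integral_eq_zero_iff_of_nonneg (fun x => sq_nonneg _) hint).1 h0] with x hx
    exact sub_eq_zero.1 (pow_eq_zero_iff two_ne_zero |>.1 hx)
  obtain ⟨x₀, htri₀, hdeg₀⟩ := (htri.and hdeg).exists
  set B := Prod.mk x₀ ⁻¹' S with hB
  have hBm : MeasurableSet B := hsec x₀
  have hBc : μ.real Bᶜ = μ.real univ / 2 := by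
    rw [measureReal_compl hBm, hdeg₀]; ring
  have hmeas : ∀ s t : Set Ω, μ.real s = μ.real t → μ s = μ t := fun s t h => by
    rwa [measureReal_def, measureReal_def,
      ENNReal.toReal_eq_toReal_iff' (measure_ne_top _ _) (measure_ne_top _ _)] at h
  have h1 : ∀ᵐ y ∂μ, y ∈ B → ∀ᵐ z ∂μ, ((y, z) ∈ S ↔ z ∉ B) := by
    filter_upwards [htri₀, hdeg] with y hy hdy hyB
    have hsub : (Prod.mk y ⁻¹' S : Set Ω) ≤ᵐ[μ] Bᶜ := by
      filter_upwards [hy] with z hz hyz hzB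
      exact hz ⟨hyB, hyz, (hsymm _ _).1 hzB⟩
    have heq := ae_eq_of_ae_subset_of_measure_ge hsub (hmeas _ _ (hBc.trans hdy.symm)).le
      (hsec y).nullMeasurableSet (measure_ne_top _ _)
    filter_upwards [heq] with z hz
    exact iff_of_eq hz
  have hP : MeasurableSet {q : Ω × Ω | q.1 ∈ B → (q ∈ S ↔ q.2 ∉ B)} :=
    .imp (measurable_fst hBm) (.iff hS (measurable_snd hBm).compl)
  have h1' : ∀ᵐ y ∂μ, ∀ᵐ z ∂μ, y ∈ B → ((y, z) ∈ S ↔ z ∉ B) := by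
    filter_upwards [h1] with y hy
    by_cases hyB : y ∈ B
    · filter_upwards [hy hyB] with z hz _ using hz
    · exact .of_forall fun z h => absurd h hyB
  have h2 : ∀ᵐ y ∂μ, ∀ᵐ z ∂μ, z ∈ B → ((z, y) ∈ S ↔ y ∉ B) :=
    (Measure.ae_ae_comm (p := fun y z => y ∈ B → ((y, z) ∈ S ↔ z ∉ B)) hP).1 h1'
  refine ⟨B, hBm, hdeg₀, ?_⟩
  have hQ : MeasurableSet {q : Ω × Ω | q ∈ S ↔ ¬(q.1 ∈ B ↔ q.2 ∈ B)} :=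
    .iff hS (MeasurableSet.compl (.iff (measurable_fst hBm) (measurable_snd hBm)))
  rw [Measure.ae_prod_iff_ae_ae hQ]
  filter_upwards [h1', h2, hdeg] with y hy1 hy2 hdy
  by_cases hyB : y ∈ B
  · filter_upwards [hy1] with z hz
    have := hz hyB
    tauto
  · have hsub : B ≤ᵐ[μ] (Prod.mk y ⁻¹' S : Set Ω) := by
      filter_upwards [hy2] with z hz hzB
      exact (hsymm _ _).1 ((hz hzB).2 hyB)
    have heq := ae_eq_of_ae_subset_of_measure_ge hsub (hmeas _ _ (hdy.trans hdeg₀.symm)).le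
      hBm.nullMeasurableSet (measure_ne_top _ _)
    filter_upwards [heq] with z hz
    have hz' : z ∈ B ↔ (y, z) ∈ S := iff_of_eq hz
    tauto

end Mantel

lemma I0_zero : I0 0 = 0 := by simp [I0]

lemma I0_one : I0 1 = 0 := by simp [I0]

lemma measurable_I0 : Measurable I0 := by
  unfold I0
  fun_prop

lemma mul_log_tangent {u p : ℝ} (hu : 0 ≤ u) (hp : 0 < p) :
    u - p ≤ u * log u - u * log p ∧ (u - p = u * log u - u * log p → u = p) := by
  rcases hu.eq_or_lt with rfl | hu
  · simp only [zero_mul, zero_sub]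
    exact ⟨by linarith, fun h => by linarith⟩
  · have hlog : log (p / u) = log p - log u := log_div hp.ne' hu.ne'
    have hmul : u * (p / u - 1) = p - u := by field_simp
    constructor
    · have h := log_le_sub_one_of_pos (div_pos hp hu)
      have := mul_le_mul_of_nonneg_left h hu.le
      rw [hmul, hlog] at this
      linarith
    · intro h
      by_contra hne
      have hne' : p / u ≠ 1 := fun h1 => hne ((div_eq_one_iff_eq hu.ne').1 h1).symm
      have := mul_lt_mul_of_pos_left (log_lt_sub_one_of_pos (div_pos hp hu) hne') hu
      rw [hmul, hlog] at this
      linarith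

/-- `I₀` lies above its tangent line at `p ∈ (0,1)`, touching it only at `p`. -/
lemma I0_tangent {u p : ℝ} (hu : u ∈ Icc (0 : ℝ) 1) (hp : p ∈ Ioo (0 : ℝ) 1) :
    (u * log p + (1 - u) * log (1 - p)) / 2 ≤ I0 u ∧
      (I0 u = (u * log p + (1 - u) * log (1 - p)) / 2 → u = p) := by
  have h1 := mul_log_tangent hu.1 hp.1
  have h2 := mul_log_tangent (u := 1 - u) (p := 1 - p) (by linarith [hu.2]) (by linarith [hp.2])
  unfold I0
  exact ⟨by linarith [h1.1, h2.1], fun h => h1.2 (by linarith [h1.1, h2.1])⟩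

lemma abs_I0_le {u : ℝ} (hu : u ∈ Icc (0 : ℝ) 1) : |I0 u| ≤ 1 := by
  have h1 := (mul_log_tangent hu.1 one_pos).1
  have h2 := (mul_log_tangent (u := 1 - u) (by linarith [hu.2]) one_pos).1
  have h3 := mul_nonpos_of_nonneg_of_nonpos hu.1 (log_nonpos hu.1 hu.2)
  have h4 := mul_nonpos_of_nonneg_of_nonpos (sub_nonneg.2 hu.2)
    (log_nonpos (sub_nonneg.2 hu.2) (by linarith [hu.1]))
  simp only [log_one, mul_zero, sub_zero] at h1 h2
  unfold I0
  rw [abs_le]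
  constructor <;> linarith

lemma ae_eq_zero_of_triple_integral_eq_zero {Ω : Type*} [MeasurableSpace Ω] {μ : Measure Ω}
    [IsFiniteMeasure μ] {h : Ω → Ω → ℝ} (hm : Measurable (Function.uncurry h))
    (h01 : ∀ x y, h x y ∈ Icc (0 : ℝ) 1)
    (htri : ∫ x, ∫ y, ∫ z, h x y * h y z * h z x ∂μ ∂μ ∂μ = 0) :
    ∀ᵐ x ∂μ, ∀ᵐ y ∂μ, ∀ᵐ z ∂μ, h x y * h y z * h z x = 0 := by
  have hT0 : ∀ x y z, 0 ≤ h x y * h y z * h z x := fun x y z =>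
    mul_nonneg (mul_nonneg (h01 _ _).1 (h01 _ _).1) (h01 _ _).1
  have hT1 : ∀ x y z, h x y * h y z * h z x ≤ 1 := fun x y z =>
    mul_le_one₀ (mul_le_one₀ (h01 _ _).2 (h01 _ _).1 (h01 _ _).2) (h01 _ _).1 (h01 _ _).2
  have hTm : Measurable fun q : (Ω × Ω) × Ω => h q.1.1 q.1.2 * h q.1.2 q.2 * h q.2 q.1.1 := by
    have e1 : Measurable fun q : (Ω × Ω) × Ω => h q.1.1 q.1.2 := hm.comp measurable_fst
    have e2 : Measurable fun q : (Ω × Ω) × Ω => h q.1.2 q.2 :=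
      hm.comp (measurable_fst.snd.prodMk measurable_snd)
    have e3 : Measurable fun q : (Ω × Ω) × Ω => h q.2 q.1.1 :=
      hm.comp (measurable_snd.prodMk measurable_fst.fst)
    exact (e1.mul e2).mul e3
  have hTint : Integrable (fun q : (Ω × Ω) × Ω => h q.1.1 q.1.2 * h q.1.2 q.2 * h q.2 q.1.1)
      ((μ.prod μ).prod μ) :=
    integrable_of_measurable_of_abs_le hTm 1 fun q => abs_le.2
      ⟨by linarith [hT0 q.1.1 q.1.2 q.2], hT1 _ _ _⟩
  have hint2 := hTint.integral_prod_left
  have e : ∫ q, h q.1.1 q.1.2 * h q.1.2 q.2 * h q.2 q.1.1 ∂((μ.prod μ).prod μ) = 0 := by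
    rw [integral_prod _ hTint, integral_prod _ hint2]
    exact htri
  have hae := (integral_eq_zero_iff_of_nonneg (fun q : (Ω × Ω) × Ω => hT0 q.1.1 q.1.2 q.2) hTint).1 e
  have h1 := Measure.ae_ae_of_ae_prod (Measure.ae_ae_of_ae_prod hae)
  exact h1

/-- A triangle-free weight of density `p L² / 2` whose rate attains the lower bound `(L² / 2) I₀(p)`
is the constant `p` on a balanced complete bipartite relation. -/
lemma exists_bipartite_of_rate_eq {Ω : Type*} [MeasurableSpace Ω] {μ : Measure Ω}
    [IsFiniteMeasure μ] {h : Ω → Ω → ℝ} {p : ℝ} (hm : Measurable (Function.uncurry h))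
    (hsymm : ∀ x y, h x y = h y x) (h01 : ∀ x y, h x y ∈ Icc (0 : ℝ) 1)
    (htri : ∫ x, ∫ y, ∫ z, h x y * h y z * h z x ∂μ ∂μ ∂μ = 0) (hp : p ∈ Ioc (0 : ℝ) 1)
    (hdens : ∫ q, h q.1 q.2 ∂μ.prod μ = p * (μ.real univ ^ 2 / 2))
    (hrate : ∫ q, I0 (h q.1 q.2) ∂μ.prod μ = μ.real univ ^ 2 / 2 * I0 p) :
    ∃ A : Set Ω, MeasurableSet A ∧ μ.real A = μ.real univ / 2 ∧
      ∀ᵐ q ∂μ.prod μ, (¬(q.1 ∈ A ↔ q.2 ∈ A) → h q.1 q.2 = p) ∧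
        ((q.1 ∈ A ↔ q.2 ∈ A) → h q.1 q.2 = 0) := by
  classical
  set M := μ.real univ ^ 2 / 2 with hM
  have hm' : Measurable fun q : Ω × Ω => h q.1 q.2 := hm
  set S : Set (Ω × Ω) := {q | 0 < h q.1 q.2} with hSdef
  have hS : MeasurableSet S := measurableSet_lt measurable_const hm'
  have hSsymm : ∀ x y, (x, y) ∈ S ↔ (y, x) ∈ S := fun x y => by
    simp only [hSdef, mem_ofPred_eq, hsymm x y]
  have hStri : ∀ᵐ x ∂μ, ∀ᵐ y ∂μ, ∀ᵐ z ∂μ, ¬((x, y) ∈ S ∧ (y, z) ∈ S ∧ (z, x) ∈ S) := by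
    filter_upwards [ae_eq_zero_of_triple_integral_eq_zero hm h01 htri] with x hx
    filter_upwards [hx] with y hy
    filter_upwards [hy] with z hz
    rintro ⟨h1, h2, h3⟩
    exact (mul_pos (mul_pos h1 h2) h3).ne' hz
  have hnot : ∀ q, q ∉ S → h q.1 q.2 = 0 := fun q hq =>
    le_antisymm (not_lt.1 hq) (h01 _ _).1
  have hle := measureReal_prod_le_of_triangleFree hS hSsymm hStri
  rw [← hM] at hle
  have hhint : Integrable (fun q : Ω × Ω => h q.1 q.2) (μ.prod μ) :=
    integrable_of_measurable_of_abs_le hm' 1 fun q =>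
      abs_le.2 ⟨by linarith [(h01 q.1 q.2).1], (h01 _ _).2⟩
  have hIint : Integrable (fun q : Ω × Ω => I0 (h q.1 q.2)) (μ.prod μ) :=
    integrable_of_measurable_of_abs_le (measurable_I0.comp hm') 1 fun q => abs_I0_le (h01 _ _)
  have hSint : Integrable (S.indicator (1 : Ω × Ω → ℝ)) (μ.prod μ) :=
    (integrable_const (1 : ℝ)).indicator hS
  have hSval : ∫ q, S.indicator (1 : Ω × Ω → ℝ) q ∂μ.prod μ = (μ.prod μ).real S :=
    integral_indicator_one hS
  have hmain : (μ.prod μ).real S = M ∧ ∀ᵐ q ∂μ.prod μ, q ∈ S → h q.1 q.2 = p := by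
    rcases hp.2.eq_or_lt with rfl | hp1
    · have hnn : ∀ q : Ω × Ω, 0 ≤ S.indicator (1 : Ω × Ω → ℝ) q - h q.1 q.2 := fun q => by
        by_cases hq : q ∈ S
        · simpa [indicator_of_mem hq] using (h01 q.1 q.2).2
        · simp [indicator_of_notMem hq, hnot q hq]
      have hval : ∫ q, (S.indicator (1 : Ω × Ω → ℝ) q - h q.1 q.2) ∂μ.prod μ =
          (μ.prod μ).real S - M := by
        rw [integral_sub hSint hhint, hSval, hdens, one_mul]
      have hge : 0 ≤ (μ.prod μ).real S - M := hval ▸ integral_nonneg hnn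
      have heq : (μ.prod μ).real S = M := by linarith
      refine ⟨heq, ?_⟩
      rw [heq, sub_self] at hval
      filter_upwards [(integral_eq_zero_iff_of_nonneg hnn (hSint.sub hhint)).1 hval] with q hq hqS
      simp only [indicator_of_mem hqS, Pi.one_apply, Pi.zero_apply] at hq
      linarith
    · have hp' : p ∈ Ioo (0 : ℝ) 1 := ⟨hp.1, hp1⟩
      set D : Ω × Ω → ℝ := fun q => I0 (h q.1 q.2) - h q.1 q.2 * ((log p - log (1 - p)) / 2) -
        S.indicator (1 : Ω × Ω → ℝ) q * (log (1 - p) / 2) with hD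
      have hDS : ∀ q ∈ S, D q =
          I0 (h q.1 q.2) - (h q.1 q.2 * log p + (1 - h q.1 q.2) * log (1 - p)) / 2 :=
        fun q hq => by simp only [hD, indicator_of_mem hq, Pi.one_apply]; ring
      have hnn : ∀ q, 0 ≤ D q := fun q => by
        by_cases hq : q ∈ S
        · rw [hDS q hq]; linarith [(I0_tangent (h01 q.1 q.2) hp').1]
        · simp [hD, indicator_of_notMem hq, hnot q hq, I0_zero]
      have hDint : Integrable D (μ.prod μ) :=
        (hIint.sub (hhint.mul_const _)).sub (hSint.mul_const _)
      have hval : ∫ q, D q ∂μ.prod μ = (M - (μ.prod μ).real S) * (log (1 - p) / 2) := by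
        simp only [hD]
        rw [integral_sub (f := fun q : Ω × Ω => I0 (h q.1 q.2) -
            h q.1 q.2 * ((log p - log (1 - p)) / 2)) (hIint.sub (hhint.mul_const _))
            (hSint.mul_const _), integral_sub hIint (hhint.mul_const _), integral_mul_const,
          integral_mul_const, hSval, hdens, hrate, I0]
        ring
      have hge : 0 ≤ (M - (μ.prod μ).real S) * (log (1 - p) / 2) := hval ▸ integral_nonneg hnn
      have hlog : log (1 - p) < 0 := log_neg (by linarith) (by linarith [hp.1])
      have heq : (μ.prod μ).real S = M := by nlinarith
      refine ⟨heq, ?_⟩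
      rw [heq, sub_self, zero_mul] at hval
      filter_upwards [(integral_eq_zero_iff_of_nonneg hnn hDint).1 hval] with q hq hqS
      rw [hDS q hqS, Pi.zero_apply] at hq
      exact (I0_tangent (h01 q.1 q.2) hp').2 (by linarith)
  obtain ⟨A, hA, hAL, hbip⟩ := exists_balanced_bipartition hS hSsymm hStri hmain.1
  refine ⟨A, hA, hAL, ?_⟩
  filter_upwards [hbip, hmain.2] with q hq hqp
  exact ⟨fun hne => hqp (hq.2 hne), fun he => hnot q fun hqS => hq.1 hqS he⟩

section Scallop

variable {ℓ : ℕ} {c : ℝ}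

lemma scallop_param {n e c : ℝ} (hn : 2 ≤ n) (he : e ∈ Icc (1 - 1 / n) (1 - 1 / (n + 1)))
    (hc : c = (n + √(n * (n - e * (n + 1)))) / (n * (n + 1))) :
    0 < c ∧ n * c ≤ 1 ∧ 1 - e = 1 - 2 * n * c + n * (n + 1) * c ^ 2 := by
  have hn0 : 0 < n := by linarith
  have hn1 : 0 < n + 1 := by linarith
  have h1 : n - 1 ≤ e * n := by
    have h := mul_le_mul_of_nonneg_right he.1 hn0.le
    have h' : (1 - 1 / n) * n = n - 1 := by field_simp
    linarith
  have h2 : e * (n + 1) ≤ n := by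
    have h := mul_le_mul_of_nonneg_right he.2 hn1.le
    have h' : (1 - 1 / (n + 1)) * (n + 1) = n := by field_simp; ring
    linarith
  have hnn : 0 ≤ n * (n - e * (n + 1)) := mul_nonneg hn0.le (by linarith)
  have hsq := Real.sq_sqrt hnn
  have hs0 := Real.sqrt_nonneg (n * (n - e * (n + 1)))
  set s := √(n * (n - e * (n + 1)))
  have hs1 : s ≤ 1 := by nlinarith
  have hcs : c * (n * (n + 1)) = n + s := by
    rw [hc]; field_simp
  refine ⟨by rw [hc]; positivity, ?_, ?_⟩
  · by_contra! h
    nlinarith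
  · have hs : s = c * (n * (n + 1)) - n := by linarith
    rw [hs] at hsq
    have hprod : n * (n + 1) * (e - (2 * n * c - n * (n + 1) * c ^ 2)) = 0 := by linarith
    have := (mul_eq_zero.1 hprod).resolve_left (by positivity)
    linarith

/-- The points `x` and `y` lie in different cells of the partition of the line at the points
`c, 2c, …, (ℓ-1)c`. -/
def IsSeparated (ℓ : ℕ) (c x y : ℝ) : Prop :=
  ∃ k : ℕ, 1 ≤ k ∧ k ≤ ℓ - 1 ∧
    ((x < (k : ℝ) * c ∧ (k : ℝ) * c < y) ∨ (y < (k : ℝ) * c ∧ (k : ℝ) * c < x))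

lemma IsSeparated.symm {x y : ℝ} (h : IsSeparated ℓ c x y) : IsSeparated ℓ c y x := by
  obtain ⟨k, h1, h2, h3⟩ := h
  exact ⟨k, h1, h2, h3.symm⟩

lemma natCast_mul_le_of_le_sub_one (hc : 0 < c) {k : ℕ} (hk : k ≤ ℓ - 1) (hℓ : 1 ≤ ℓ) :
    (k : ℝ) * c ≤ ((ℓ : ℝ) - 1) * c := by
  have h : (k : ℝ) ≤ (ℓ : ℝ) - 1 := by
    rw [← Nat.cast_one, ← Nat.cast_sub hℓ]
    exact_mod_cast hk
  exact mul_le_mul_of_nonneg_right h hc.le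

lemma exists_mem_cell (hc : 0 < c) (hℓ : 1 ≤ ℓ) {x : ℝ} (hx0 : 0 ≤ x)
    (hx : x < ((ℓ : ℝ) - 1) * c) (hgen : ∀ k : ℕ, x ≠ (k : ℝ) * c) :
    ∃ i ∈ Finset.range (ℓ - 1), x ∈ Ioo ((i : ℝ) * c) (((i : ℝ) + 1) * c) := by
  have hle : (⌊x / c⌋₊ : ℝ) * c ≤ x :=
    (le_div_iff₀ hc).1 (Nat.floor_le (div_nonneg hx0 hc.le))
  have hlt : x < ((⌊x / c⌋₊ : ℝ) + 1) * c := (div_lt_iff₀ hc).1 (Nat.lt_floor_add_one _)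
  refine ⟨⌊x / c⌋₊, ?_, lt_of_le_of_ne hle (Ne.symm (hgen _)), hlt⟩
  rw [Finset.mem_range]
  by_contra! h
  have h' : (ℓ : ℝ) - 1 ≤ (⌊x / c⌋₊ : ℝ) := by
    rw [← Nat.cast_one, ← Nat.cast_sub hℓ]
    exact_mod_cast h
  nlinarith

lemma cell_unique (hc : 0 < c) {i j : ℕ} {x : ℝ} (hi : x ∈ Ioo ((i : ℝ) * c) (((i : ℝ) + 1) * c))
    (hj : x ∈ Ioo ((j : ℝ) * c) (((j : ℝ) + 1) * c)) : i = j := by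
  have h1 := lt_of_mul_lt_mul_right (hi.1.trans hj.2) hc.le
  have h2 := lt_of_mul_lt_mul_right (hj.1.trans hi.2) hc.le
  have h3 : i < j + 1 := by exact_mod_cast h1
  have h4 : j < i + 1 := by exact_mod_cast h2
  omega

lemma not_mem_cell_of_le (hc : 0 < c) (hℓ : 1 ≤ ℓ) {i : ℕ} (hi : i ∈ Finset.range (ℓ - 1)) {x : ℝ}
    (hx : ((ℓ : ℝ) - 1) * c ≤ x) : x ∉ Ioo ((i : ℝ) * c) (((i : ℝ) + 1) * c) := fun h => by
  have h1 := natCast_mul_le_of_le_sub_one hc (k := i + 1) (by rw [Finset.mem_range] at hi; omega) hℓ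
  push_cast at h1
  linarith [h.2]

lemma not_isSeparated_of_mem_cell (hc : 0 < c) {i : ℕ} {x y : ℝ}
    (hx : x ∈ Ioo ((i : ℝ) * c) (((i : ℝ) + 1) * c))
    (hy : y ∈ Ioo ((i : ℝ) * c) (((i : ℝ) + 1) * c)) : ¬IsSeparated ℓ c x y := by
  rintro ⟨k, -, -, h⟩
  have key : ∀ {u v : ℝ}, u ∈ Ioo ((i : ℝ) * c) (((i : ℝ) + 1) * c) →
      v ∈ Ioo ((i : ℝ) * c) (((i : ℝ) + 1) * c) → ¬(u < (k : ℝ) * c ∧ (k : ℝ) * c < v) := by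
    rintro u v hu hv ⟨h1, h2⟩
    have h3 := lt_of_mul_lt_mul_right (hu.1.trans h1) hc.le
    have h4 := lt_of_mul_lt_mul_right (h2.trans hv.2) hc.le
    have h5 : i < k := by exact_mod_cast h3
    have h6 : k < i + 1 := by exact_mod_cast h4
    omega
  rcases h with h | h
  · exact key hx hy h
  · exact key hy hx h

lemma isSeparated_of_notMem_cell {i : ℕ} (hi : i ∈ Finset.range (ℓ - 1)) {x y : ℝ}
    (hx : x ∈ Ioo ((i : ℝ) * c) (((i : ℝ) + 1) * c)) (hy0 : 0 ≤ y)
    (hgen : ∀ k : ℕ, y ≠ (k : ℝ) * c)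
    (hy : y ∉ Ioo ((i : ℝ) * c) (((i : ℝ) + 1) * c)) : IsSeparated ℓ c x y := by
  rw [Finset.mem_range] at hi
  rcases lt_or_gt_of_ne (hgen i) with h | h
  · refine ⟨i, Nat.one_le_iff_ne_zero.2 ?_, by omega, Or.inr ⟨h, hx.1⟩⟩
    rintro rfl
    simp only [Nat.cast_zero, zero_mul] at h
    linarith
  · have h1 : ((i + 1 : ℕ) : ℝ) * c < y := by
      refine lt_of_le_of_ne ?_ (Ne.symm (hgen _))
      by_contra! h2
      push_cast at h2
      exact hy ⟨h, h2⟩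
    exact ⟨i + 1, by omega, by omega, Or.inl ⟨by push_cast; exact hx.2, h1⟩⟩

/-- Generic points of `[0,1]` that are not both in the last cell are either separated, or in a
common cell among the first `ℓ-1` ones. -/
lemma isSeparated_or_exists_cell (hc : 0 < c) (hℓ : 1 ≤ ℓ) {x y : ℝ} (hx0 : 0 ≤ x) (hy0 : 0 ≤ y)
    (hx : ∀ k : ℕ, x ≠ (k : ℝ) * c) (hy : ∀ k : ℕ, y ≠ (k : ℝ) * c)
    (hxy : ¬(((ℓ : ℝ) - 1) * c ≤ x ∧ ((ℓ : ℝ) - 1) * c ≤ y)) :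
    (IsSeparated ℓ c x y) ∨ ∃ i ∈ Finset.range (ℓ - 1),
      x ∈ Ioo ((i : ℝ) * c) (((i : ℝ) + 1) * c) ∧ y ∈ Ioo ((i : ℝ) * c) (((i : ℝ) + 1) * c) := by
  rcases not_and_or.1 hxy with h | h
  · obtain ⟨i, hi, hxi⟩ := exists_mem_cell hc hℓ hx0 (not_le.1 h) hx
    by_cases hyi : y ∈ Ioo ((i : ℝ) * c) (((i : ℝ) + 1) * c)
    · exact Or.inr ⟨i, hi, hxi, hyi⟩
    · exact Or.inl (isSeparated_of_notMem_cell hi hxi hy0 hy hyi)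
  · obtain ⟨i, hi, hyi⟩ := exists_mem_cell hc hℓ hy0 (not_le.1 h) hy
    by_cases hxi : x ∈ Ioo ((i : ℝ) * c) (((i : ℝ) + 1) * c)
    · exact Or.inr ⟨i, hi, hxi, hyi⟩
    · exact Or.inl (isSeparated_of_notMem_cell hi hyi hx0 hx hxi).symm

instance : IsProbabilityMeasure unitMeasure := ⟨by simp [unitMeasure]⟩

lemma ae_unitMeasure_ne_mul (c : ℝ) : ∀ᵐ x ∂unitMeasure, ∀ k : ℕ, x ≠ (k : ℝ) * c := by
  have h : ∀ k : ℕ, ∀ᵐ x ∂unitMeasure, x ≠ (k : ℝ) * c := fun k =>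
    ae_restrict_of_ae (Measure.ae_ne volume _)
  exact ae_all_iff.2 h

lemma ae_unitMeasure_mem_Icc : ∀ᵐ x ∂unitMeasure, x ∈ Icc (0 : ℝ) 1 :=
  ae_restrict_mem measurableSet_Icc

lemma ae_prod_unitMeasure {P : ℝ → Prop} (h : ∀ᵐ x ∂unitMeasure, P x) :
    ∀ᵐ q ∂unitMeasure.prod unitMeasure, P q.1 ∧ P q.2 :=
  (Measure.quasiMeasurePreserving_fst.ae h).and (Measure.quasiMeasurePreserving_snd.ae h)

lemma unitMeasure_prod_restrict {a : ℝ} (ha : 0 ≤ a) :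
    (unitMeasure.prod unitMeasure).restrict (Icc a 1 ×ˢ Icc a 1) =
      (volume.restrict (Icc a 1)).prod (volume.restrict (Icc a 1)) := by
  rw [← Measure.prod_restrict, unitMeasure, Measure.restrict_restrict measurableSet_Icc,
    inter_eq_left.2 (Icc_subset_Icc_left ha)]

/-- The defining block conditions of the multipartite graphons on the `ℓ`-th scallop. -/
lemma ae_block_values (hc : 0 < c) (hℓ : 1 ≤ ℓ) {g : ℝ → ℝ → ℝ}
    (hblocks : ∀ᵐ q ∂(unitMeasure.prod unitMeasure),
      (∀ k : ℕ, 1 ≤ k → k ≤ ℓ - 1 →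
        ((q.1 < (k : ℝ) * c ∧ (k : ℝ) * c < q.2) ∨
         (q.2 < (k : ℝ) * c ∧ (k : ℝ) * c < q.1)) → g q.1 q.2 = 1) ∧
      (∀ k : ℕ, 1 ≤ k → k ≤ ℓ - 1 →
        (((k : ℝ) - 1) * c < q.1 ∧ q.1 < (k : ℝ) * c ∧
         ((k : ℝ) - 1) * c < q.2 ∧ q.2 < (k : ℝ) * c) → g q.1 q.2 = 0)) :
    ∀ᵐ q ∂(unitMeasure.prod unitMeasure), (IsSeparated ℓ c q.1 q.2 → g q.1 q.2 = 1) ∧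
      (¬IsSeparated ℓ c q.1 q.2 → q ∉ Icc (((ℓ : ℝ) - 1) * c) 1 ×ˢ Icc (((ℓ : ℝ) - 1) * c) 1 →
        g q.1 q.2 = 0) ∧
      1 - g q.1 q.2 =
        ∑ i ∈ Finset.range (ℓ - 1), (Ioo ((i : ℝ) * c) (((i : ℝ) + 1) * c) ×ˢ
          Ioo ((i : ℝ) * c) (((i : ℝ) + 1) * c)).indicator (1 : ℝ × ℝ → ℝ) q +
        (Icc (((ℓ : ℝ) - 1) * c) 1 ×ˢ Icc (((ℓ : ℝ) - 1) * c) 1).indicator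
          (fun q => 1 - g q.1 q.2) q := by
  filter_upwards [hblocks, ae_prod_unitMeasure (ae_unitMeasure_ne_mul c),
    ae_prod_unitMeasure ae_unitMeasure_mem_Icc] with q hq hgen hmem
  have h1 : IsSeparated ℓ c q.1 q.2 → g q.1 q.2 = 1 := by
    rintro ⟨k, hk1, hk2, h⟩
    exact hq.1 k hk1 hk2 h
  have h0 : ∀ i ∈ Finset.range (ℓ - 1), q.1 ∈ Ioo ((i : ℝ) * c) (((i : ℝ) + 1) * c) →
      q.2 ∈ Ioo ((i : ℝ) * c) (((i : ℝ) + 1) * c) → g q.1 q.2 = 0 := fun i hi hx hy => by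
    rw [Finset.mem_range] at hi
    refine hq.2 (i + 1) (by omega) (by omega) ?_
    push_cast
    rw [add_sub_cancel_right]
    exact ⟨hx.1, hx.2, hy.1, hy.2⟩
  by_cases hcorner : q ∈ Icc (((ℓ : ℝ) - 1) * c) 1 ×ˢ Icc (((ℓ : ℝ) - 1) * c) 1
  · refine ⟨h1, fun _ h => absurd hcorner h, ?_⟩
    rw [indicator_of_mem hcorner, Finset.sum_eq_zero, zero_add]
    exact fun i hi => indicator_of_notMem
      (fun h => not_mem_cell_of_le hc hℓ hi hcorner.1.1 h.1) _
  · have hdich := isSeparated_or_exists_cell hc hℓ hmem.1.1 hmem.2.1 hgen.1 hgen.2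
      fun h => hcorner ⟨⟨h.1, hmem.1.2⟩, ⟨h.2, hmem.2.2⟩⟩
    refine ⟨h1, fun hns _ => ?_, ?_⟩
    · obtain ⟨i, hi, hx, hy⟩ := hdich.resolve_left hns
      exact h0 i hi hx hy
    rw [indicator_of_notMem hcorner, add_zero]
    rcases hdich with h | ⟨i, hi, hx, hy⟩
    · rw [h1 h, sub_self, Finset.sum_eq_zero]
      exact fun i _ => indicator_of_notMem
        (fun hm => not_isSeparated_of_mem_cell hc hm.1 hm.2 h) _
    · rw [h0 i hi hx hy, Finset.sum_eq_single i, indicator_of_mem (Set.mem_prod.2 ⟨hx, hy⟩), sub_zero, Pi.one_apply]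
      · exact fun j _ hji => indicator_of_notMem (fun hm => hji (cell_unique hc hm.1 hx)) _
      · exact fun h => absurd hi h

lemma measureReal_unitMeasure_cell (hc : 0 < c) (hℓ : 1 ≤ ℓ) (hc1 : ((ℓ : ℝ) - 1) * c ≤ 1) {i : ℕ}
    (hi : i ∈ Finset.range (ℓ - 1)) :
    unitMeasure.real (Ioo ((i : ℝ) * c) (((i : ℝ) + 1) * c)) = c := by
  have h1 := natCast_mul_le_of_le_sub_one hc (k := i + 1) (by rw [Finset.mem_range] at hi; omega) hℓ
  push_cast at h1
  have hsub : Ioo ((i : ℝ) * c) (((i : ℝ) + 1) * c) ⊆ Icc 0 1 := fun x hx =>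
    ⟨(mul_nonneg i.cast_nonneg hc.le).trans hx.1.le, hx.2.le.trans (h1.trans hc1)⟩
  rw [unitMeasure, measureReal_def, Measure.restrict_apply measurableSet_Ioo,
    inter_eq_left.2 hsub, Real.volume_Ioo, ENNReal.toReal_ofReal (by nlinarith)]
  ring

lemma gScallop_of_isSeparated {p x y : ℝ} (h : IsSeparated ℓ c x y) : gScallop ℓ c p x y = 1 :=
  if_pos h

lemma gScallop_of_across {p x y : ℝ} (h : ¬IsSeparated ℓ c x y)
    (h' : (((ℓ : ℝ) - 1) * c < x ∧ x < (1 + ((ℓ : ℝ) - 1) * c) / 2 ∧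
            (1 + ((ℓ : ℝ) - 1) * c) / 2 < y) ∨
          (((ℓ : ℝ) - 1) * c < y ∧ y < (1 + ((ℓ : ℝ) - 1) * c) / 2 ∧
            (1 + ((ℓ : ℝ) - 1) * c) / 2 < x)) : gScallop ℓ c p x y = p :=
  (if_neg h).trans (if_pos h')

lemma gScallop_of_not_across {p x y : ℝ} (h : ¬IsSeparated ℓ c x y)
    (h' : ¬((((ℓ : ℝ) - 1) * c < x ∧ x < (1 + ((ℓ : ℝ) - 1) * c) / 2 ∧
            (1 + ((ℓ : ℝ) - 1) * c) / 2 < y) ∨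
          (((ℓ : ℝ) - 1) * c < y ∧ y < (1 + ((ℓ : ℝ) - 1) * c) / 2 ∧
            (1 + ((ℓ : ℝ) - 1) * c) / 2 < x))) : gScallop ℓ c p x y = 0 :=
  (if_neg h).trans (if_neg h')

/-- A multipartite graphon whose corner block is `p` times a balanced complete bipartite graphon is
equivalent to the scallop graphon. -/
lemma graphonEquiv_gScallop {p : ℝ} (hc : 0 < c) (hℓ : 1 ≤ ℓ) (hc1 : ((ℓ : ℝ) - 1) * c < 1)
    {g : ℝ → ℝ → ℝ} {A : Set ℝ} (hA : MeasurableSet A) (hAsub : A ⊆ Icc (((ℓ : ℝ) - 1) * c) 1)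
    (hvol : volume A = ENNReal.ofReal ((1 - ((ℓ : ℝ) - 1) * c) / 2))
    (hval : ∀ᵐ q ∂(unitMeasure.prod unitMeasure), (IsSeparated ℓ c q.1 q.2 → g q.1 q.2 = 1) ∧
      (¬IsSeparated ℓ c q.1 q.2 → q ∉ Icc (((ℓ : ℝ) - 1) * c) 1 ×ˢ Icc (((ℓ : ℝ) - 1) * c) 1 →
        g q.1 q.2 = 0))
    (hcorner : ∀ᵐ q ∂(unitMeasure.prod unitMeasure),
      q ∈ Icc (((ℓ : ℝ) - 1) * c) 1 ×ˢ Icc (((ℓ : ℝ) - 1) * c) 1 →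
        (¬(q.1 ∈ A ↔ q.2 ∈ A) → g q.1 q.2 = p) ∧ ((q.1 ∈ A ↔ q.2 ∈ A) → g q.1 q.2 = 0)) :
    GraphonEquiv g (gScallop ℓ c p) := by
  have hℓ' : (1 : ℝ) ≤ ℓ := by exact_mod_cast hℓ
  have ha0 : 0 ≤ ((ℓ : ℝ) - 1) * c := mul_nonneg (by linarith) hc.le
  obtain ⟨τ, hτ, hτid, hτA, hτB⟩ := exists_measurePreserving_sort ha0 hc1.le hA hAsub hvol
  refine ⟨id, τ, .id _, hτ, ?_⟩
  set a := ((ℓ : ℝ) - 1) * c with ha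
  have hτgen : ∀ᵐ x ∂unitMeasure, τ x ≠ a ∧ τ x ≠ (1 + a) / 2 :=
    hτ.quasiMeasurePreserving.ae ((ae_restrict_of_ae (Measure.ae_ne volume _)).and
      (ae_restrict_of_ae (Measure.ae_ne volume _)))
  have hane : ∀ᵐ x ∂unitMeasure, x ≠ a := ae_restrict_of_ae (Measure.ae_ne volume _)
  filter_upwards [hval, hcorner, ae_prod_unitMeasure hτgen, ae_prod_unitMeasure hane,
    ae_prod_unitMeasure ae_unitMeasure_mem_Icc] with q hq hqc hgen hne hmem
  obtain ⟨x, y⟩ := q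
  simp only [mem_prod, id] at hq hqc hgen hne hmem ⊢
  have hge : ∀ u ∈ Icc (0 : ℝ) 1, a ≤ u → a ≤ τ u := fun u hu hau => by
    by_cases huA : u ∈ A
    · exact (hτA u huA).1
    · linarith [(hτB u ⟨⟨hau, hu.2⟩, huA⟩).1]
  have hle : ∀ u ∈ Icc (0 : ℝ) 1, a < τ u → a ≤ u := fun u hu hau => by
    by_contra! h
    rw [hτid u h] at hau
    linarith
  have hkl : ∀ u ∈ Icc (0 : ℝ) 1, ∀ k : ℕ, k ≤ ℓ - 1 → (τ u < k * c ↔ u < k * c) := by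
    intro u hu k hk
    have hka := natCast_mul_le_of_le_sub_one hc hk hℓ
    rw [← ha] at hka
    rcases lt_or_ge u a with h | h
    · rw [hτid u h]
    · have := hge u hu h
      constructor <;> intro h' <;> linarith
  have hkg : ∀ u ∈ Icc (0 : ℝ) 1, τ u ≠ a → u ≠ a → ∀ k : ℕ, k ≤ ℓ - 1 →
      (k * c < τ u ↔ k * c < u) := by
    intro u hu h1 h2 k hk
    have hka := natCast_mul_le_of_le_sub_one hc hk hℓ
    rw [← ha] at hka
    rcases lt_or_ge u a with h | h
    · rw [hτid u h]
    · have h3 := lt_of_le_of_ne (hge u hu h) h1.symm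
      have h4 := lt_of_le_of_ne h h2.symm
      constructor <;> intro <;> linarith
  have hsep : IsSeparated ℓ c (τ x) (τ y) ↔ IsSeparated ℓ c x y := by
    refine exists_congr fun k => and_congr_right fun _ => and_congr_right fun hk => ?_
    rw [hkl x hmem.1 k hk, hkl y hmem.2 k hk, hkg x hmem.1 hgen.1.1 hne.1 k hk,
      hkg y hmem.2 hgen.2.1 hne.2 k hk]
  by_cases hs : IsSeparated ℓ c x y
  · rw [hq.1 hs, gScallop_of_isSeparated (hsep.2 hs)]
  have hs' : ¬IsSeparated ℓ c (τ x) (τ y) := fun h => hs (hsep.1 h)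
  by_cases hxy : x ∈ Icc a 1 ∧ y ∈ Icc a 1
  · have hAlt : ∀ u ∈ A, τ u ≠ a ∧ τ u ≠ (1 + a) / 2 → a < τ u ∧ τ u < (1 + a) / 2 :=
      fun u hu h => ⟨lt_of_le_of_ne (hτA u hu).1 h.1.symm, lt_of_le_of_ne (hτA u hu).2 h.2⟩
    have hBlt : ∀ u ∈ Icc a 1, u ∉ A → τ u ≠ a ∧ τ u ≠ (1 + a) / 2 → (1 + a) / 2 < τ u :=
      fun u hu hu' h => lt_of_le_of_ne (hτB u ⟨hu, hu'⟩).1 h.2.symm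
    have hqc := hqc hxy
    by_cases hxA : x ∈ A <;> by_cases hyA : y ∈ A
    · rw [hqc.2 (iff_of_true hxA hyA), gScallop_of_not_across hs']
      have h1 := hAlt x hxA hgen.1
      have h2 := hAlt y hyA hgen.2
      rintro (h | h) <;> linarith [h.2.2]
    · rw [hqc.1 fun h => hyA (h.1 hxA), gScallop_of_across hs']
      have h1 := hAlt x hxA hgen.1
      exact Or.inl ⟨h1.1, h1.2, hBlt y hxy.2 hyA hgen.2⟩
    · rw [hqc.1 fun h => hxA (h.2 hyA), gScallop_of_across hs']
      have h1 := hAlt y hyA hgen.2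
      exact Or.inr ⟨h1.1, h1.2, hBlt x hxy.1 hxA hgen.1⟩
    · rw [hqc.2 (iff_of_false hxA hyA), gScallop_of_not_across hs']
      have h1 := hBlt x hxy.1 hxA hgen.1
      have h2 := hBlt y hxy.2 hyA hgen.2
      rintro (h | h) <;> linarith [h.2.1]
  · rw [hq.2 hs hxy, gScallop_of_not_across hs']
    rintro (h | h)
    · exact hxy ⟨⟨hle x hmem.1 h.1, hmem.1.2⟩, hle y hmem.2 (by linarith [h.2.2]), hmem.2.2⟩
    · exact hxy ⟨⟨hle x hmem.1 (by linarith [h.2.2]), hmem.1.2⟩, hle y hmem.2 h.1, hmem.2.2⟩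

end Scallop

/-- any graphon of the multipartite form on the `ℓ`-th scallop
    attaining the minimal rate `((1−(ℓ−1)c)²/2)·I₀(p)` is equivalent to the
    explicit optimizer `g₀`. -/
theorem scallop_minimizer_unique (ℓ : ℕ) (hℓ : 2 ≤ ℓ) (e c p : ℝ)
    (he : e ∈ Icc (1 - 1 / (ℓ : ℝ)) (1 - 1 / ((ℓ : ℝ) + 1)))
    (hc : c = ((ℓ : ℝ) + Real.sqrt ((ℓ : ℝ) * ((ℓ : ℝ) - e * ((ℓ : ℝ) + 1)))) /
      ((ℓ : ℝ) * ((ℓ : ℝ) + 1)))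
    (hp : p = 4 * c * (1 - (ℓ : ℝ) * c) / (1 - ((ℓ : ℝ) - 1) * c) ^ 2)
    (g : ℝ → ℝ → ℝ) (hg : IsGraphon g) (hge : edgeDensity g = e)
    (hblocks : ∀ᵐ q ∂(unitMeasure.prod unitMeasure),
      (∀ k : ℕ, 1 ≤ k → k ≤ ℓ - 1 →
        ((q.1 < (k : ℝ) * c ∧ (k : ℝ) * c < q.2) ∨
         (q.2 < (k : ℝ) * c ∧ (k : ℝ) * c < q.1)) → g q.1 q.2 = 1) ∧
      (∀ k : ℕ, 1 ≤ k → k ≤ ℓ - 1 →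
        (((k : ℝ) - 1) * c < q.1 ∧ q.1 < (k : ℝ) * c ∧
         ((k : ℝ) - 1) * c < q.2 ∧ q.2 < (k : ℝ) * c) → g q.1 q.2 = 0))
    (htri : ∫ x in Icc (((ℓ : ℝ) - 1) * c) 1, ∫ y in Icc (((ℓ : ℝ) - 1) * c) 1,
      ∫ z in Icc (((ℓ : ℝ) - 1) * c) 1, g x y * g y z * g z x = 0)
    (hgI : rate g = (1 - ((ℓ : ℝ) - 1) * c) ^ 2 / 2 * I0 p) :
    GraphonEquiv g (gScallop ℓ c p) := by
  have hn : (2 : ℝ) ≤ ℓ := by exact_mod_cast hℓ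
  have hℓ1 : 1 ≤ ℓ := by omega
  obtain ⟨hc0, hcℓ, hec⟩ := scallop_param hn he hc
  set a := ((ℓ : ℝ) - 1) * c with ha
  have ha0 : 0 ≤ a := mul_nonneg (by linarith) hc0.le
  have ha1 : a < 1 := by linarith
  have hac : a + c = ℓ * c := by rw [ha]; ring
  have hval := ae_block_values hc0 hℓ1 hblocks
  simp only [← ha] at hval
  set μ := volume.restrict (Icc a 1) with hμ
  have hμuniv : μ.real univ = 1 - a := by
    rw [hμ, measureReal_restrict_apply_univ, Real.volume_real_Icc_of_le ha1.le]
  have hm : Measurable fun q : ℝ × ℝ => g q.1 q.2 := hg.1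
  have hint : ∀ (ν : Measure (ℝ × ℝ)) [IsFiniteMeasure ν],
      Integrable (fun q : ℝ × ℝ => g q.1 q.2) ν := fun ν _ =>
    integrable_of_measurable_of_abs_le hm 1 fun q =>
      abs_le.2 ⟨by linarith [(hg.2.2 q.1 q.2).1], (hg.2.2 _ _).2⟩
  have hJJ : MeasurableSet (Icc a 1 ×ˢ Icc a 1) := measurableSet_Icc.prod measurableSet_Icc
  have hcorner : ∀ f : ℝ × ℝ → ℝ, ∫ q, (Icc a 1 ×ˢ Icc a 1).indicator f q
      ∂unitMeasure.prod unitMeasure = ∫ q, f q ∂μ.prod μ := fun f => by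
    rw [integral_indicator hJJ, unitMeasure_prod_restrict ha0]
  have hdens : ∫ q, g q.1 q.2 ∂μ.prod μ = p * (μ.real univ ^ 2 / 2) := by
    have h1 : ∫ q, (1 - g q.1 q.2) ∂unitMeasure.prod unitMeasure = 1 - e := by
      rw [integral_sub (integrable_const _) (hint _), integral_prod _ (hint _), ← hge,
        integral_const, probReal_univ, one_smul]
      rfl
    have hcell : ∀ i ∈ Finset.range (ℓ - 1), ∫ q, (Ioo ((i : ℝ) * c) (((i : ℝ) + 1) * c) ×ˢ
        Ioo ((i : ℝ) * c) (((i : ℝ) + 1) * c)).indicator (1 : ℝ × ℝ → ℝ) q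
        ∂unitMeasure.prod unitMeasure = c ^ 2 := fun i hi => by
      rw [integral_indicator_one (measurableSet_Ioo.prod measurableSet_Ioo),
        measureReal_prod_prod, measureReal_unitMeasure_cell hc0 hℓ1 ha1.le hi, sq]
    have hcellint : ∀ i ∈ Finset.range (ℓ - 1), Integrable ((Ioo ((i : ℝ) * c)
        (((i : ℝ) + 1) * c) ×ˢ Ioo ((i : ℝ) * c) (((i : ℝ) + 1) * c)).indicator
        (1 : ℝ × ℝ → ℝ)) (unitMeasure.prod unitMeasure) := fun i _ =>
      (integrable_const (1 : ℝ)).indicator (measurableSet_Ioo.prod measurableSet_Ioo)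
    have hsub : Integrable (fun q : ℝ × ℝ => 1 - g q.1 q.2) (unitMeasure.prod unitMeasure) :=
      (integrable_const _).sub (hint _)
    have h2 := integral_congr_ae (hval.mono fun q hq => hq.2.2)
    rw [h1, integral_add (integrable_finsetSum _ hcellint)
        (hsub.indicator hJJ),
      integral_finsetSum _ hcellint, Finset.sum_congr rfl hcell, hcorner,
      integral_sub (integrable_const _) (hint _), Finset.sum_const, Finset.card_range,
      integral_const, ← univ_prod_univ, measureReal_prod_prod, hμuniv, nsmul_eq_mul,
      Nat.cast_sub hℓ1, Nat.cast_one, smul_eq_mul, hec] at h2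
    have hpM : p * ((1 - a) ^ 2 / 2) = 2 * c * (1 - ℓ * c) := by
      have : (1 - a) ≠ 0 := by linarith
      rw [hp]; field_simp; ring
    rw [hμuniv, hpM]
    rw [ha] at h2
    linarith
  have hrate : ∫ q, I0 (g q.1 q.2) ∂μ.prod μ = μ.real univ ^ 2 / 2 * I0 p := by
    have hIint : Integrable (fun q : ℝ × ℝ => I0 (g q.1 q.2)) (unitMeasure.prod unitMeasure) :=
      integrable_of_measurable_of_abs_le (measurable_I0.comp hm) 1 fun q => abs_I0_le (hg.2.2 _ _)
    have h1 : ∫ q, I0 (g q.1 q.2) ∂unitMeasure.prod unitMeasure = rate g := integral_prod _ hIint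
    rw [← hcorner, hμuniv, ← hgI, ← h1]
    refine integral_congr_ae (hval.mono fun q hq => ?_)
    by_cases hqJ : q ∈ Icc a 1 ×ˢ Icc a 1
    · exact indicator_of_mem hqJ _
    · simp only [indicator_of_notMem hqJ]
      by_cases hs : IsSeparated ℓ c q.1 q.2
      · rw [hq.1 hs, I0_one]
      · rw [hq.2.1 hs hqJ, I0_zero]
  have hp0 : 0 ≤ p := by
    rw [hp]
    exact div_nonneg (mul_nonneg (by linarith) (by linarith)) (sq_nonneg _)
  have hp1 : p ≤ 1 := by
    rw [hp, div_le_one (pow_pos (by linarith) 2)]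
    nlinarith [sq_nonneg (c - (1 - ℓ * c))]
  obtain ⟨A, hA, hAL, hbip⟩ : ∃ A : Set ℝ, MeasurableSet A ∧ μ.real A = μ.real univ / 2 ∧
      ∀ᵐ q ∂μ.prod μ, (¬(q.1 ∈ A ↔ q.2 ∈ A) → g q.1 q.2 = p) ∧
        ((q.1 ∈ A ↔ q.2 ∈ A) → g q.1 q.2 = 0) := by
    rcases hp0.eq_or_lt with h0 | h0
    · refine ⟨Icc a ((1 + a) / 2), measurableSet_Icc, ?_, ?_⟩
      · rw [hμuniv, hμ, measureReal_restrict_apply measurableSet_Icc,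
          inter_eq_left.2 (Icc_subset_Icc_right (by linarith)),
          Real.volume_real_Icc_of_le (by linarith)]
        ring
      · rw [← h0, zero_mul] at hdens
        filter_upwards [(integral_eq_zero_iff_of_nonneg (fun q : ℝ × ℝ => (hg.2.2 q.1 q.2).1)
          (hint _)).1 hdens] with q hq
        exact ⟨fun _ => hq.trans h0, fun _ => hq⟩
    · exact exists_bipartite_of_rate_eq hg.1 hg.2.1 hg.2.2 htri ⟨h0, hp1⟩ hdens hrate
  refine graphonEquiv_gScallop (A := A ∩ Icc a 1) hc0 hℓ1 ha1 (hA.inter measurableSet_Icc)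
    inter_subset_right ?_ (hval.mono fun q hq => ⟨hq.1, hq.2.1⟩) ?_
  · rw [← ha, ← hμuniv, ← hAL, ofReal_measureReal, hμ, Measure.restrict_apply hA]
  · rw [hμ, ← unitMeasure_prod_restrict ha0, ae_restrict_iff' hJJ] at hbip
    filter_upwards [hbip] with q hq hqJ
    have h1 : q.1 ∈ A ∩ Icc a 1 ↔ q.1 ∈ A := and_iff_left hqJ.1
    have h2 : q.2 ∈ A ∩ Icc a 1 ↔ q.2 ∈ A := and_iff_left hqJ.2
    rw [h1, h2]
    exact hq hqJ
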